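/- Let f : [a,b] → ℝ be continuously differentiable and suppose that f′ has exactly p zeros in [a,b], with p < ∞. Then for every δ > 0: (1/(2δ)) ∫_a^b |f′(t)| 1_{{|f(t)| ≤ δ}} dt ≤ 1 + p. -/

import Mathlib

open MeasureTheory Real
open scoped Classical

/-- Rolle's theorem turns two points of `[a,b]` with equal value and with equally many zeros of the
derivative to their left into a single point. -/
theorem injOn_of_ncard_zeros_lt_eq {a b : ℝ} {f f' : ℝ → ℝ}
    (hf : ∀ t ∈ Set.Icc a b, HasDerivWithinAt f (f' t) (Set.Icc a b) t)
    (hfin : {t ∈ Set.Icc a b | f' t = 0}.Finite) (k : ℕ) :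
    Set.InjOn f {t ∈ Set.Icc a b | {z ∈ Set.Icc a b | f' z = 0 ∧ z < t}.ncard = k} := by
  have key : ∀ x ∈ Set.Icc a b, ∀ y ∈ Set.Icc a b, x < y → f x = f y →
      {z ∈ Set.Icc a b | f' z = 0 ∧ z < x}.ncard <
        {z ∈ Set.Icc a b | f' z = 0 ∧ z < y}.ncard := by
    intro x hx y hy hxy hfxy
    obtain ⟨z, hz, hz0⟩ := exists_hasDerivAt_eq_zero (f := f) (f' := f') hxy
      (fun t ht => (hf t ⟨hx.1.trans ht.1, ht.2.trans hy.2⟩).continuousWithinAt.mono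
        (Set.Icc_subset_Icc hx.1 hy.2)) hfxy
      (fun t ht => (hf t ⟨hx.1.trans ht.1.le, ht.2.le.trans hy.2⟩).hasDerivAt
        (Icc_mem_nhds (hx.1.trans_lt ht.1) (ht.2.trans_le hy.2)))
    refine Set.ncard_lt_ncard ⟨fun w hw => ⟨hw.1, hw.2.1, hw.2.2.trans hxy⟩, fun h => ?_⟩
      (hfin.subset fun w hw => ⟨hw.1, hw.2.1⟩)
    have := h (a := z) ⟨⟨hx.1.trans hz.1.le, hz.2.le.trans hy.2⟩, hz0, hz.2⟩
    exact lt_asymm this.2.2 hz.1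
  rintro x ⟨hx, hxk⟩ y ⟨hy, hyk⟩ hxy
  rcases lt_trichotomy x y with h | h | h
  · exact absurd (hxk.trans hyk.symm) (key x hx y hy h hxy).ne
  · exact h
  · exact absurd (hyk.trans hxk.symm) (key y hy x hx h hxy.symm).ne

/-- An injective piece of `f` with values in `[-δ,δ]` has total variation at most `2δ`. -/
theorem setIntegral_abs_deriv_le_of_injOn {s : Set ℝ} {f f' : ℝ → ℝ} {δ : ℝ} (hδ : 0 ≤ δ)
    (hs : MeasurableSet s) (hf : ∀ t ∈ s, HasDerivWithinAt f (f' t) s t) (hinj : Set.InjOn f s)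
    (hbound : ∀ t ∈ s, |f t| ≤ δ) :
    ∫ t in s, |f' t| ≤ 2 * δ := by
  have h := integral_image_eq_integral_abs_deriv_smul hs hf hinj (fun _ => (1 : ℝ))
  simp only [smul_eq_mul, mul_one] at h
  rw [← h, setIntegral_const, smul_eq_mul, mul_one]
  calc volume.real (f '' s) ≤ volume.real (Set.Icc (-δ) δ) :=
        measureReal_mono (Set.image_subset_iff.2 fun t ht => abs_le.1 (hbound t ht))
          (by simp)
    _ = 2 * δ := by
        rw [Real.volume_real_Icc_of_le (by linarith)]; ring

/-- Kac–Rice type bound (inequality `(p3')`): if `f : [a,b] → ℝ` is continuously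
differentiable and `f'` has exactly `p` zeros in `[a,b]`, then for every `δ > 0`,
`(1/(2δ)) ∫_a^b |f'(t)| 1_{|f(t)| ≤ δ} dt ≤ 1 + p`. -/
theorem kac_rice_upper_bound
    (a b : ℝ) (hab : a ≤ b) (f : ℝ → ℝ)
    (hdiff : DifferentiableOn ℝ f (Set.Icc a b))
    (hcont : ContinuousOn (derivWithin f (Set.Icc a b)) (Set.Icc a b))
    (p : ℕ)
    (hzeros : {t ∈ Set.Icc a b | derivWithin f (Set.Icc a b) t = 0}.Finite ∧
      {t ∈ Set.Icc a b | derivWithin f (Set.Icc a b) t = 0}.ncard = p) :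
    ∀ δ : ℝ, 0 < δ →
      (2 * δ)⁻¹ *
        (∫ t in a..b,
          (if |f t| ≤ δ then |derivWithin f (Set.Icc a b) t| else 0)) ≤
        1 + p := by
  intro δ hδ
  obtain ⟨hfin, hcard⟩ := hzeros
  have hf : ∀ t ∈ Set.Icc a b,
      HasDerivWithinAt f (derivWithin f (Set.Icc a b) t) (Set.Icc a b) t :=
    fun t ht => (hdiff t ht).hasDerivWithinAt
  set f' := derivWithin f (Set.Icc a b)
  let N : ℝ → ℕ := fun t => {z ∈ Set.Icc a b | f' z = 0 ∧ z < t}.ncard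
  have hNmeas : Measurable N := Monotone.measurable fun x y hxy =>
    Set.ncard_le_ncard (fun w hw => ⟨hw.1, hw.2.1, hw.2.2.trans_le hxy⟩)
      (hfin.subset fun w hw => ⟨hw.1, hw.2.1⟩)
  have hNle : ∀ t, N t ≤ p := fun t =>
    hcard ▸ Set.ncard_le_ncard (fun w hw => ⟨hw.1, hw.2.1⟩) hfin
  let A : Set ℝ := Set.Icc a b ∩ f ⁻¹' Set.Icc (-δ) δ
  have hA : MeasurableSet A :=
    (hdiff.continuousOn.preimage_isClosed_of_isClosed isClosed_Icc isClosed_Icc).measurableSet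
  have hint : IntegrableOn (fun t => |f' t|) (Set.Icc a b) := hcont.abs.integrableOn_Icc
  have hsub : ∀ k, A ∩ N ⁻¹' {k} ⊆ {t ∈ Set.Icc a b | N t = k} := fun k t ht => ⟨ht.1.1, ht.2⟩
  have hmeas : ∀ k, MeasurableSet (A ∩ N ⁻¹' {k}) := fun k =>
    hA.inter (hNmeas (measurableSet_singleton k))
  have hintegral : (∫ t in a..b, if |f t| ≤ δ then |f' t| else 0) = ∫ t in A, |f' t| := by
    have hAsub : Set.Icc a b ∩ A = A := Set.inter_eq_self_of_subset_right Set.inter_subset_left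
    rw [intervalIntegral.integral_of_le hab, ← integral_Icc_eq_integral_Ioc, ← hAsub,
      ← setIntegral_indicator hA]
    refine setIntegral_congr_fun measurableSet_Icc fun t ht => ?_
    simp only [Set.indicator_apply, A, Set.mem_inter_iff, ht, true_and, Set.mem_preimage,
      Set.mem_Icc, abs_le]
  have hunion : A = ⋃ k ∈ Finset.range (p + 1), A ∩ N ⁻¹' {k} := by
    ext t
    simpa using fun _ => hNle t
  have hpieces : ∫ t in A, |f' t| ≤ (p + 1) * (2 * δ) := by
    rw [hunion, integral_biUnion_finset _ (fun k _ => hmeas k)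
      (fun i _ j _ hij => Set.disjoint_left.2 fun t hi hj => hij (hi.2.symm.trans hj.2))
      (fun k _ => hint.mono_set fun t ht => ht.1.1)]
    calc ∑ k ∈ Finset.range (p + 1), ∫ t in A ∩ N ⁻¹' {k}, |f' t|
        ≤ ∑ _k ∈ Finset.range (p + 1), 2 * δ :=
          Finset.sum_le_sum fun k _ => setIntegral_abs_deriv_le_of_injOn hδ.le (hmeas k)
            (fun t ht => (hf t ht.1.1).mono fun _ hx => hx.1.1)
            ((injOn_of_ncard_zeros_lt_eq hf hfin k).mono (hsub k))
            (fun t ht => abs_le.2 ht.1.2)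
      _ = (p + 1) * (2 * δ) := by simp
  rw [hintegral, inv_mul_le_iff₀ (by positivity)]
  linarith
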